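/- For all integers n ≥ 1 and d with 0 < d ≤ n, the following identity holds in K: Σ_{r=0}^{d} [2n+1−2r] · [2d−2n−1 choose d−r] · [2n+1 choose r] = 0. -/

import Mathlib

open Finset

/-- Symmetric q-integer `[n] = (qⁿ − q⁻ⁿ)/(q − q⁻¹)` for `n : ℤ`. -/
noncomputable def qint {K : Type*} [Field K] (q : K) (n : ℤ) : K :=
  (q ^ n - q ^ (-n)) / (q - q⁻¹)

/-- q-factorial `[n]! = [1][2]⋯[n]`. -/
noncomputable def qfact {K : Type*} [Field K] (q : K) : ℕ → K
  | 0 => 1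
  | n + 1 => qfact q n * qint q ((n : ℤ) + 1)

/-- Generalized q-binomial `[n choose k] = [n][n−1]⋯[n−k+1]/[k]!` for `n : ℤ`, `k : ℕ`. -/
noncomputable def qbinomG {K : Type*} [Field K] (q : K) (n : ℤ) (k : ℕ) : K :=
  (∏ i ∈ Finset.range k, qint q (n - i)) / qfact q k

theorem qint_neg {K : Type*} [Field K] (q : K) (n : ℤ) : qint q (-n) = -qint q n := by
  simp only [qint, neg_neg]
  ring

theorem qint_ne_zero {K : Type*} [Field K] {q : K}
    (hq : ∀ n : ℕ, 1 ≤ n → q ^ (n : ℤ) ≠ q ^ (-(n : ℤ))) {n : ℕ} (hn : 1 ≤ n) :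
    qint q (n : ℤ) ≠ 0 := by
  refine div_ne_zero (sub_ne_zero.mpr (hq n hn)) (sub_ne_zero.mpr ?_)
  simpa using hq 1 le_rfl

/-- `[d][N − 2m] − [m][N − d − m] = [N − m][d − m]`. -/
theorem qint_mul_sub_qint_mul {K : Type*} [Field K] {q : K} (hq0 : q ≠ 0) (N d m : ℤ) :
    qint q d * qint q (N - 2 * m) - qint q m * qint q (N - d - m) =
      qint q (N - m) * qint q (d - m) := by
  simp only [qint, div_mul_div_comm, ← sub_div]
  congr 1
  simp only [mul_sub, sub_mul, ← zpow_add₀ hq0]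
  ring_nf

theorem qbinomG_succ_mul {K : Type*} [Field K] (q : K) (N : ℤ) (k : ℕ)
    (hk : qint q ((k : ℤ) + 1) ≠ 0) :
    qbinomG q N (k + 1) * qint q ((k : ℤ) + 1) = qbinomG q N k * qint q (N - k) := by
  simp only [qbinomG, qfact, prod_range_succ]
  rw [div_mul_eq_mul_div, mul_div_mul_right _ _ hk, div_mul_eq_mul_div]

/-- Closed form for the partial sums of
`[N − 2r] [2d − N choose d − r] [N choose r]`, multiplied by `[d]`. -/
theorem qint_mul_sum_range_qbinomG {K : Type*} [Field K] {q : K} (hq0 : q ≠ 0)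
    (hq : ∀ n : ℕ, 1 ≤ n → q ^ (n : ℤ) ≠ q ^ (-(n : ℤ))) (N : ℤ) (d m : ℕ) (hm : m ≤ d) :
    qint q d * ∑ r ∈ range m,
        qint q (N - 2 * (r : ℤ)) * qbinomG q (2 * (d : ℤ) - N) (d - r) * qbinomG q N r =
      -(qint q m * qint q (N - d - m) * qbinomG q (2 * (d : ℤ) - N) (d - m) *
        qbinomG q N m) := by
  induction m with
  | zero => simp [qint]
  | succ m ih =>
    obtain ⟨k, rfl⟩ : ∃ k, d = m + 1 + k := Nat.exists_eq_add_of_le hm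
    have hB := qbinomG_succ_mul q N m (by exact_mod_cast qint_ne_zero hq (Nat.le_add_left 1 m))
    have hA := qbinomG_succ_mul q (2 * ((m + 1 + k : ℕ) : ℤ) - N) k
      (by exact_mod_cast qint_ne_zero hq (Nat.le_add_left 1 k))
    have hT := qint_mul_sub_qint_mul hq0 N ((m + 1 + k : ℕ) : ℤ) m
    have hneg := qint_neg q (N - ((m + 1 + k : ℕ) : ℤ) - ((m + 1 : ℕ) : ℤ))
    rw [show -(N - ((m + 1 + k : ℕ) : ℤ) - ((m + 1 : ℕ) : ℤ)) =
      2 * ((m + 1 + k : ℕ) : ℤ) - N - k by push_cast; ring] at hneg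
    rw [show ((m + 1 + k : ℕ) : ℤ) - m = k + 1 by push_cast; ring] at hT
    rw [sum_range_succ, mul_add, ih (by omega), show m + 1 + k - m = k + 1 by omega,
      show m + 1 + k - (m + 1) = k by omega]
    rw [hneg] at hA
    rw [show ((m + 1 : ℕ) : ℤ) = (m : ℤ) + 1 by push_cast; ring] at hA ⊢
    generalize qbinomG q (2 * ((m + 1 + k : ℕ) : ℤ) - N) = A at *
    linear_combination A (k + 1) * qbinomG q N m * hT +
      qbinomG q N m * qint q (N - m) * hA +
      qint q (N - ((m + 1 + k : ℕ) : ℤ) - ((m : ℤ) + 1)) * A k * hB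

/-- For `0 < d ≤ n`:
`Σ_{r=0}^{d} [2n+1−2r] [2d−2n−1 choose d−r] [2n+1 choose r] = 0`. -/
theorem stmt5 {K : Type*} [Field K] [CharZero K] (q : K) (hq0 : q ≠ 0)
    (hq : ∀ n : ℕ, 1 ≤ n → q ^ (n : ℤ) ≠ q ^ (-(n : ℤ)))
    (n d : ℕ) (hn : 1 ≤ n) (hd : 0 < d) (hdn : d ≤ n) :
    ∑ r ∈ Finset.range (d + 1),
      qint q (2 * (n : ℤ) + 1 - 2 * (r : ℤ)) *
        qbinomG q (2 * (d : ℤ) - 2 * (n : ℤ) - 1) (d - r) *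
        qbinomG q (2 * (n : ℤ) + 1) r = 0 := by
  have hd0 : qint q (d : ℤ) ≠ 0 := qint_ne_zero hq hd
  have h := qint_mul_sum_range_qbinomG hq0 hq (2 * (n : ℤ) + 1) d d le_rfl
  rw [show 2 * (d : ℤ) - 2 * (n : ℤ) - 1 = 2 * (d : ℤ) - (2 * (n : ℤ) + 1) by ring]
  refine (mul_eq_zero.mp ?_).resolve_left hd0
  rw [sum_range_succ, mul_add, h,
    show 2 * (n : ℤ) + 1 - d - d = 2 * (n : ℤ) + 1 - 2 * d by ring]
  ring
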